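/- Let 𝔾 be a finite connected transitive graph. For every s > 0 and every p ∈ (0,1), the variance of Z_{≥s} satisfies Var_p[Z_{≥s}] ≤ V·χ(p). In fact, the stronger bound 𝔼_p[Z_{≥s}²] ≤ (𝔼_p[Z_{≥s}])² + V·χ_{≥s}(p)·(1 − P_{≥s}(p)) holds, where χ_{≥s}(p) = 𝔼_p[|C(0)|·I[|C(0)| ≥ s]]. -/

import Mathlib

noncomputable section
open Classical

namespace Percolation

variable {V : Type*} [Fintype V] [DecidableEq V]

/-- A percolation configuration: an assignment of occupied (`true`) or
vacant (`false`) to each bond of the graph. -/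
def Config (G : SimpleGraph V) : Type _ := G.edgeSet → Bool

noncomputable instance (G : SimpleGraph V) : Fintype G.edgeSet :=
  Fintype.ofFinite _

noncomputable instance (G : SimpleGraph V) : Fintype (Config G) :=
  inferInstanceAs (Fintype (G.edgeSet → Bool))

/-- The probability weight of a configuration under the product Bernoulli
measure with parameter `p`. -/
def weight (G : SimpleGraph V) (p : ℝ) (ω : Config G) : ℝ :=
  ∏ e : G.edgeSet, if ω e then p else 1 - p

/-- The probability of an event under the percolation measure `ℙ_p`. -/
def prob (G : SimpleGraph V) (p : ℝ) (A : Config G → Prop) : ℝ :=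
  ∑ ω : Config G, if A ω then weight G p ω else 0

/-- The expectation of a random variable under the percolation measure `ℙ_p`. -/
def expect (G : SimpleGraph V) (p : ℝ) (f : Config G → ℝ) : ℝ :=
  ∑ ω : Config G, weight G p ω * f ω

/-- The subgraph consisting of the occupied bonds of a configuration. -/
def occupied (G : SimpleGraph V) (ω : Config G) : SimpleGraph V :=
  SimpleGraph.fromEdgeSet {e | ∃ h : e ∈ G.edgeSet, ω ⟨e, h⟩ = true}

/-- The cluster `C(x)` of the vertex `x`: all vertices joined to `x` by a path
of occupied bonds (including `x` itself). -/
def cluster (G : SimpleGraph V) (ω : Config G) (x : V) : Finset V :=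
  Finset.univ.filter fun y => (occupied G ω).Reachable x y

/-- The susceptibility `χ(p)`: the expected size of the cluster of `x₀`. -/
def chi (G : SimpleGraph V) (x₀ : V) (p : ℝ) : ℝ :=
  expect G p fun ω => ((cluster G ω x₀).card : ℝ)

/-- The two-point function `τ_p(x,y) = ℙ_p(x ↔ y)`. -/
def tau (G : SimpleGraph V) (p : ℝ) (x y : V) : ℝ :=
  prob G p fun ω => (occupied G ω).Reachable x y

/-- The triangle diagram `∇_p(x,y)`. -/
def triangle (G : SimpleGraph V) (p : ℝ) (x y : V) : ℝ :=
  ∑ u : V, ∑ v : V, tau G p x u * tau G p u v * tau G p v y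

/-- The Kronecker delta `δ_{x,y}`. -/
def kron (x y : V) : ℝ := if x = y then 1 else 0

/-- `∇̄_p`: the maximum of the triangle diagram over bonds `{x,y} ∈ 𝔹`. -/
def nablaBar (G : SimpleGraph V) (p : ℝ) : ℝ :=
  sSup {t : ℝ | ∃ x y : V, G.Adj x y ∧ t = triangle G p x y}

/-- A graph is (vertex-)transitive if any vertex can be mapped to any other
by a graph automorphism. -/
def IsTransitive (G : SimpleGraph V) : Prop :=
  ∀ x y : V, ∃ φ : G ≃g G, φ x = y

/-- The size `|C_max|` of the largest cluster. -/
def maxCluster (G : SimpleGraph V) (ω : Config G) : ℕ :=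
  Finset.univ.sup fun x => (cluster G ω x).card

/-- The cluster size distribution `P_{≥k}(p) = ℙ_p(|C(x₀)| ≥ k)`. -/
def Pgeq (G : SimpleGraph V) (x₀ : V) (p : ℝ) (k : ℝ) : ℝ :=
  prob G p fun ω => k ≤ ((cluster G ω x₀).card : ℝ)

/-- The magnetization `M(p,γ)`. -/
def magnetization (G : SimpleGraph V) (x₀ : V) (p γ : ℝ) : ℝ :=
  ∑ k ∈ Finset.Icc 1 (Fintype.card V),
    (1 - (1 - γ) ^ k) * prob G p fun ω => (cluster G ω x₀).card = k

/-- `Z_{≥s}`: the number of vertices lying in clusters of size at least `s`. -/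
def Zgeq (G : SimpleGraph V) (s : ℝ) (ω : Config G) : ℝ :=
  ∑ x : V, if s ≤ ((cluster G ω x).card : ℝ) then (1 : ℝ) else 0

/-- The variance of a random variable under `ℙ_p`. -/
def variance (G : SimpleGraph V) (p : ℝ) (f : Config G → ℝ) : ℝ :=
  expect G p (fun ω => f ω ^ 2) - (expect G p f) ^ 2

/-- The restricted susceptibility `χ_{≥s}(p) = 𝔼_p[|C(x₀)| I[|C(x₀)| ≥ s]]`. -/
def chiGeq (G : SimpleGraph V) (x₀ : V) (p : ℝ) (s : ℝ) : ℝ :=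
  expect G p fun ω =>
    if s ≤ ((cluster G ω x₀).card : ℝ) then ((cluster G ω x₀).card : ℝ) else 0

/-- The restricted susceptibility `χ_{<s}(p) = 𝔼_p[|C(x₀)| I[|C(x₀)| < s]]`. -/
def chiLt (G : SimpleGraph V) (x₀ : V) (p : ℝ) (s : ℝ) : ℝ :=
  expect G p fun ω =>
    if ((cluster G ω x₀).card : ℝ) < s then ((cluster G ω x₀).card : ℝ) else 0

end Percolation
namespace Percolation

section Helpers
set_option linter.unusedSectionVars false
variable {V : Type*} [Fintype V] [DecidableEq V]

lemma occ_adj (G : SimpleGraph V) (ω : Config G) (u v : V) :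
    (occupied G ω).Adj u v ↔ ∃ h : s(u, v) ∈ G.edgeSet, ω ⟨s(u, v), h⟩ = true := by
  unfold occupied
  rw [SimpleGraph.fromEdgeSet_adj]
  constructor
  · rintro ⟨h, -⟩
    exact h
  · rintro ⟨h, h2⟩
    exact ⟨⟨h, h2⟩, G.ne_of_adj (by simpa using h)⟩

lemma reach_fwd {H H' : SimpleGraph V} {x y : V}
    (hH : ∀ u v, H.Reachable x u → H.Adj u v → H'.Adj u v) (h : H.Reachable x y) :
    H'.Reachable x y := by
  have h' := (SimpleGraph.reachable_iff_reflTransGen x y).1 h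
  clear h
  induction h' with
  | refl => exact SimpleGraph.Reachable.refl _
  | tail h1 h2 ih =>
    exact ih.trans (hH _ _ ((SimpleGraph.reachable_iff_reflTransGen _ _).2 h1) h2).reachable

lemma reach_bwd {H H' : SimpleGraph V} {x y : V}
    (hH : ∀ u v, H.Reachable x u → H'.Adj u v → H.Adj u v) (h : H'.Reachable x y) :
    H.Reachable x y := by
  have h' := (SimpleGraph.reachable_iff_reflTransGen x y).1 h
  clear h
  induction h' with
  | refl => exact SimpleGraph.Reachable.refl _
  | tail h1 h2 ih => exact ih.trans (hH _ _ ih h2).reachable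

/-- The edge touches the cluster of `x`. -/
def touch (G : SimpleGraph V) (x : V) (ω : Config G) (e : G.edgeSet) : Prop :=
  ∃ u ∈ e.1, (occupied G ω).Reachable x u

/-- Take `a` on the edges touching the cluster of `x` in `ω`, `b` elsewhere. -/
def mix (G : SimpleGraph V) (x : V) (ω a b : Config G) : Config G :=
  fun e => if touch G x ω e then a e else b e

lemma mix_adj_iff (G : SimpleGraph V) (x : V) (ω b : Config G) (u v : V)
    (hu : (occupied G ω).Reachable x u) :
    (occupied G (mix G x ω ω b)).Adj u v ↔ (occupied G ω).Adj u v := by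
  rw [occ_adj, occ_adj]
  refine exists_congr fun h => ?_
  have : touch G x ω ⟨s(u, v), h⟩ := ⟨u, by simp, hu⟩
  simp only [mix, if_pos this]

lemma mix_reach (G : SimpleGraph V) (x : V) (ω b : Config G) (y : V) :
    (occupied G (mix G x ω ω b)).Reachable x y ↔ (occupied G ω).Reachable x y :=
  ⟨reach_bwd fun u v hu h => (mix_adj_iff G x ω b u v hu).1 h,
    reach_fwd fun u v hu h => (mix_adj_iff G x ω b u v hu).2 h⟩

lemma mix_touch (G : SimpleGraph V) (x : V) (ω b : Config G) :
    touch G x (mix G x ω ω b) = touch G x ω := by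
  funext e
  simp only [touch, mix_reach]

lemma mix_reach' (G : SimpleGraph V) (x : V) (ω a : Config G) (y z : V)
    (hxy : ¬ (occupied G ω).Reachable x y) (h : (occupied G ω).Reachable y z) :
    (occupied G (mix G x ω a ω)).Reachable y z := by
  refine reach_fwd (fun u v hu h => ?_) h
  have hadj := h
  rw [occ_adj] at h ⊢
  obtain ⟨h1, h2⟩ := h
  refine ⟨h1, ?_⟩
  have : ¬ touch G x ω ⟨s(u, v), h1⟩ := by
    rintro ⟨w, hw, hw2⟩
    rcases Sym2.mem_iff.1 hw with rfl | rfl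
    · exact hxy (hw2.trans hu.symm)
    · exact hxy (hw2.trans (hu.trans hadj.reachable).symm)
  simp only [mix, if_neg this]
  exact h2

/-- The swap involution on pairs of configurations. -/
def swp (G : SimpleGraph V) (x : V) (q : Config G × Config G) : Config G × Config G :=
  (mix G x q.1 q.1 q.2, mix G x q.1 q.2 q.1)

lemma swp_inv (G : SimpleGraph V) (x : V) : Function.Involutive (swp G x) := by
  rintro ⟨a, b⟩
  have ht := mix_touch G x a b
  unfold swp
  refine Prod.ext ?_ ?_
  · funext e
    simp only [mix] at ht ⊢
    rw [ht]
    split_ifs <;> rfl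
  · funext e
    simp only [mix] at ht ⊢
    rw [ht]
    split_ifs <;> rfl

lemma swp_weight (G : SimpleGraph V) (x : V) (p : ℝ) (q : Config G × Config G) :
    weight G p (swp G x q).1 * weight G p (swp G x q).2 = weight G p q.1 * weight G p q.2 := by
  unfold weight
  rw [← Finset.prod_mul_distrib, ← Finset.prod_mul_distrib]
  refine Finset.prod_congr rfl fun e _ => ?_
  simp only [swp, mix]
  by_cases h : touch G x q.1 e
  · simp only [if_pos h]
  · simp only [if_neg h]
    ring

lemma weight_nonneg (G : SimpleGraph V) {p : ℝ} (hp0 : 0 < p) (hp1 : p < 1) (ω : Config G) :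
    0 ≤ weight G p ω := by
  unfold weight
  refine Finset.prod_nonneg fun e _ => ?_
  split_ifs <;> linarith

lemma weight_sum (G : SimpleGraph V) (p : ℝ) : ∑ ω : Config G, weight G p ω = 1 := by
  unfold weight
  have := (Finset.prod_univ_sum (fun _ : G.edgeSet => (Finset.univ : Finset Bool))
    (fun _ b => if b = true then p else 1 - p)).symm
  simp at this
  exact this

lemma prob_eq (G : SimpleGraph V) (p : ℝ) (A : Config G → Prop) :
    prob G p A = expect G p fun ω => if A ω then 1 else 0 := by
  unfold prob expect
  refine Finset.sum_congr rfl fun ω _ => ?_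
  by_cases h : A ω <;> simp [h]

/-- Indicator that the cluster of `x` is large. -/
def big (G : SimpleGraph V) (s : ℝ) (x : V) (ω : Config G) : Prop :=
  s ≤ ((cluster G ω x).card : ℝ)

lemma key_gen (G : SimpleGraph V) {p : ℝ} (hp0 : 0 < p) (hp1 : p < 1) (x : V)
    (L A B : Config G → Prop)
    (hL : ∀ q : Config G × Config G, L q.1 → A (swp G x q).1 ∧ B (swp G x q).2) :
    prob G p L ≤ prob G p A * prob G p B := by
  have e1 : prob G p L =
      ∑ q : Config G × Config G, (if L q.1 then weight G p q.1 else 0) * weight G p q.2 := by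
    rw [Fintype.sum_prod_type]
    simp only []
    rw [← Finset.sum_mul_sum, weight_sum, mul_one]
    rfl
  have e2 : prob G p A * prob G p B =
      ∑ q : Config G × Config G, (if A q.1 then weight G p q.1 else 0) *
        (if B q.2 then weight G p q.2 else 0) := by
    rw [Fintype.sum_prod_type]
    simp only []
    rw [← Finset.sum_mul_sum]
    rfl
  rw [e1, e2, ← Equiv.sum_comp (swp_inv G x).toPerm
    (fun q => (if A q.1 then weight G p q.1 else 0) * (if B q.2 then weight G p q.2 else 0))]
  refine Finset.sum_le_sum fun q _ => ?_
  change _ ≤ (if A (swp G x q).1 then weight G p (swp G x q).1 else 0) *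
    (if B (swp G x q).2 then weight G p (swp G x q).2 else 0)
  have w := weight_nonneg G hp0 hp1
  by_cases h : L q.1
  · obtain ⟨h1, h2⟩ := hL q h
    rw [if_pos h, if_pos h1, if_pos h2, swp_weight]
  · rw [if_neg h, zero_mul]
    refine mul_nonneg ?_ ?_ <;> split_ifs <;> first | exact w _ | exact le_rfl

lemma key (G : SimpleGraph V) {p : ℝ} (hp0 : 0 < p) (hp1 : p < 1) (s : ℝ) (x y : V) :
    prob G p (fun ω => big G s x ω ∧ big G s y ω ∧ ¬ (occupied G ω).Reachable x y) ≤
      prob G p (fun ω => big G s x ω ∧ ¬ (occupied G ω).Reachable x y) *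
        prob G p (big G s y) := by
  refine key_gen G hp0 hp1 x _ _ _ ?_
  rintro q ⟨hx, hy, hxy⟩
  have hr := mix_reach G x q.1 q.2
  have h1 : big G s x (swp G x q).1 := by
    simp only [big, swp, cluster, hr] at hx ⊢
    exact hx
  have h2 : ¬ (occupied G (swp G x q).1).Reachable x y := by
    simp only [swp, hr]
    exact hxy
  have h3 : big G s y (swp G x q).2 := by
    unfold big at hy ⊢
    refine hy.trans ?_
    norm_cast
    refine Finset.card_le_card fun z hz => ?_
    simp only [cluster, Finset.mem_filter, Finset.mem_univ, true_and] at hz ⊢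
    exact mix_reach' G x q.1 q.2 y z hxy hz
  exact ⟨⟨h1, h2⟩, h3⟩

/-- Pull back of configurations by an automorphism. -/
def pull (G : SimpleGraph V) (φ : G ≃g G) : Config G ≃ Config G :=
  Equiv.arrowCongr φ.symm.mapEdgeSet (Equiv.refl Bool)

lemma pull_weight (G : SimpleGraph V) (φ : G ≃g G) (p : ℝ) (ω : Config G) :
    weight G p (pull G φ ω) = weight G p ω := by
  unfold weight
  exact Equiv.prod_comp φ.symm.mapEdgeSet.symm (fun e => if ω e then p else 1 - p)

lemma pull_adj (G : SimpleGraph V) (φ : G ≃g G) (ω : Config G) (u v : V) :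
    (occupied G ω).Adj (φ u) (φ v) ↔ (occupied G (pull G φ ω)).Adj u v := by
  rw [occ_adj, occ_adj]
  constructor
  · rintro ⟨h, h2⟩
    refine ⟨φ.map_adj_iff.1 h, ?_⟩
    exact h2
  · rintro ⟨h, h2⟩
    refine ⟨φ.map_adj_iff.2 h, ?_⟩
    exact h2

/-- The automorphism as an isomorphism between occupied graphs. -/
def pullIso (G : SimpleGraph V) (φ : G ≃g G) (ω : Config G) :
    occupied G (pull G φ ω) ≃g occupied G ω :=
  { toEquiv := φ.toEquiv
    map_rel_iff' := by
      intro a b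
      exact pull_adj G φ ω a b }

lemma pull_card (G : SimpleGraph V) (φ : G ≃g G) (ω : Config G) (x : V) :
    (cluster G (pull G φ ω) x).card = (cluster G ω (φ x)).card := by
  refine Finset.card_equiv φ.toEquiv fun z => ?_
  simp only [cluster, Finset.mem_filter, Finset.mem_univ, true_and]
  exact ((pullIso G φ ω).reachable_iff).symm

lemma expect_trans (G : SimpleGraph V) (ht : IsTransitive G) (p : ℝ) (f : ℕ → ℝ) (x y : V) :
    expect G p (fun ω => f (cluster G ω x).card) = expect G p (fun ω => f (cluster G ω y).card) := by
  obtain ⟨φ, rfl⟩ := ht x y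
  unfold expect
  rw [← Equiv.sum_comp (pull G φ)]
  simp only [pull_weight, pull_card]

lemma expect_sum (G : SimpleGraph V) (p : ℝ) {ι : Type*} (t : Finset ι) (f : ι → Config G → ℝ) :
    expect G p (fun ω => ∑ i ∈ t, f i ω) = ∑ i ∈ t, expect G p (f i) := by
  unfold expect
  simp only [Finset.mul_sum]
  exact Finset.sum_comm

lemma expect_add (G : SimpleGraph V) (p : ℝ) (f g : Config G → ℝ) :
    expect G p (fun ω => f ω + g ω) = expect G p f + expect G p g := by
  unfold expect
  simp only [mul_add, Finset.sum_add_distrib]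

lemma expect_mono (G : SimpleGraph V) {p : ℝ} (hp0 : 0 < p) (hp1 : p < 1) {f g : Config G → ℝ}
    (h : ∀ ω, f ω ≤ g ω) : expect G p f ≤ expect G p g := by
  unfold expect
  exact Finset.sum_le_sum fun ω _ => mul_le_mul_of_nonneg_left (h ω) (weight_nonneg G hp0 hp1 ω)

lemma main_bound (G : SimpleGraph V) (htrans : IsTransitive G) (x₀ : V) (s : ℝ)
    {p : ℝ} (hp0 : 0 < p) (hp1 : p < 1) :
    expect G p (fun ω => Zgeq G s ω ^ 2) ≤
        (expect G p (Zgeq G s)) ^ 2 +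
          (Fintype.card V : ℝ) * chiGeq G x₀ p s * (1 - Pgeq G x₀ p s) := by
  have hP : ∀ x, prob G p (big G s x) = Pgeq G x₀ p s := by
    intro x
    unfold Pgeq
    rw [prob_eq, prob_eq]
    exact expect_trans G htrans p (fun n => if s ≤ (n : ℝ) then 1 else 0) x x₀
  have hZ : expect G p (Zgeq G s) = Fintype.card V * Pgeq G x₀ p s := by
    have : Zgeq G s = fun ω => ∑ x : V, if big G s x ω then (1 : ℝ) else 0 := rfl
    rw [this, expect_sum]
    simp only [← prob_eq, hP, Finset.sum_const, nsmul_eq_mul, Finset.card_univ]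
  -- connected part
  have hC : ∀ x, ∑ y : V, prob G p (fun ω => big G s x ω ∧ (occupied G ω).Reachable x y) =
      chiGeq G x₀ p s := by
    intro x
    simp only [prob_eq]
    rw [← expect_sum]
    have := expect_trans G htrans p (fun n => if s ≤ (n : ℝ) then (n : ℝ) else 0) x x₀
    unfold chiGeq
    rw [← this]
    congr 1
    funext ω
    by_cases h : big G s x ω
    · rw [if_pos (show s ≤ _ from h)]
      simp only [h, true_and, cluster, Finset.card_filter]
      push_cast
      rfl
    · rw [if_neg (show ¬ s ≤ _ from h)]
      simp [h]
  have hsplit : ∀ x y, prob G p (fun ω => big G s x ω ∧ ¬ (occupied G ω).Reachable x y) =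
      Pgeq G x₀ p s - prob G p (fun ω => big G s x ω ∧ (occupied G ω).Reachable x y) := by
    intro x y
    rw [eq_sub_iff_add_eq, ← hP x]
    simp only [prob_eq]
    rw [← expect_add]
    congr 1
    funext ω
    by_cases h : big G s x ω <;> by_cases h' : (occupied G ω).Reachable x y <;> simp [h, h']
  have hle : ∀ x y, expect G p (fun ω => (if big G s x ω then (1 : ℝ) else 0) *
        (if big G s y ω then (1 : ℝ) else 0)) ≤
      prob G p (fun ω => big G s x ω ∧ (occupied G ω).Reachable x y) +
      (Pgeq G x₀ p s - prob G p (fun ω => big G s x ω ∧ (occupied G ω).Reachable x y)) *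
        Pgeq G x₀ p s := by
    intro x y
    have hk := key G hp0 hp1 s x y
    rw [hsplit, hP] at hk
    refine le_trans ?_ (add_le_add_right hk _)
    rw [prob_eq, prob_eq, ← expect_add]
    refine expect_mono G hp0 hp1 fun ω => ?_
    by_cases h : big G s x ω <;> by_cases h' : (occupied G ω).Reachable x y <;>
      by_cases h'' : big G s y ω <;> simp [h, h', h'']
  have hZ2 : expect G p (fun ω => Zgeq G s ω ^ 2) = ∑ x : V, ∑ y : V,
      expect G p (fun ω => (if big G s x ω then (1 : ℝ) else 0) *
        (if big G s y ω then (1 : ℝ) else 0)) := by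
    simp only [← expect_sum]
    congr 1
    funext ω
    rw [sq, ← Finset.sum_mul_sum]
    rfl
  rw [hZ2, hZ]
  refine (Finset.sum_le_sum fun x _ => Finset.sum_le_sum fun y _ => hle x y).trans (le_of_eq ?_)
  simp only [Finset.sum_add_distrib, ← Finset.sum_mul, Finset.sum_sub_distrib, hC,
    Finset.sum_const, nsmul_eq_mul, Finset.card_univ]
  ring

end Helpers

end Percolation

open Percolation in
/-- Lemma 6.1: variance bound for the number `Z_{≥s}` of vertices in
clusters of size at least `s`. -/
theorem variance_Zgeq_bound
    {V : Type*} [Fintype V] [DecidableEq V]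
    (G : SimpleGraph V) [DecidableRel G.Adj]
    (hconn : G.Connected) (htrans : IsTransitive G)
    (Ω : ℕ) (hreg : G.IsRegularOfDegree Ω)
    (x₀ : V)
    (s : ℝ) (hs : 0 < s)
    (p : ℝ) (hp0 : 0 < p) (hp1 : p < 1) :
    variance G p (Zgeq G s) ≤ (Fintype.card V : ℝ) * chi G x₀ p ∧
      expect G p (fun ω => Zgeq G s ω ^ 2) ≤
        (expect G p (Zgeq G s)) ^ 2 +
          (Fintype.card V : ℝ) * chiGeq G x₀ p s * (1 - Pgeq G x₀ p s) := by
  have hmain := main_bound G htrans x₀ s hp0 hp1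
  refine ⟨?_, hmain⟩
  have hc0 : 0 ≤ chiGeq G x₀ p s := by
    unfold chiGeq expect
    refine Finset.sum_nonneg fun ω _ => mul_nonneg (weight_nonneg G hp0 hp1 ω) ?_
    beta_reduce
    split_ifs
    · exact Nat.cast_nonneg _
    · exact le_rfl
  have hc1 : chiGeq G x₀ p s ≤ chi G x₀ p := by
    refine expect_mono G hp0 hp1 fun ω => ?_
    split_ifs
    · exact le_rfl
    · exact Nat.cast_nonneg _
  have hP0 : 0 ≤ Pgeq G x₀ p s := by
    unfold Pgeq prob
    refine Finset.sum_nonneg fun ω _ => ?_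
    split_ifs
    · exact weight_nonneg G hp0 hp1 ω
    · exact le_rfl
  have hn : (0 : ℝ) ≤ Fintype.card V := Nat.cast_nonneg _
  unfold Percolation.variance
  have h1 : (Fintype.card V : ℝ) * chiGeq G x₀ p s ≤ Fintype.card V * chi G x₀ p :=
    mul_le_mul_of_nonneg_left hc1 hn
  have h2 := mul_nonneg (mul_nonneg hn hc0) hP0
  nlinarith
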